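/- arXiv:2403.19701 — 2 statements merged into one kernel-verified Lean document; each statement's English description precedes it below -/
import Mathlib

section
/- Let m ≥ 2 be an integer. For all integers n ≥ 1, the sum over all triples (k₁, k₂, k₃) of nonnegative integers with k₁ + k₂ + k₃ = n−1 of 𝒫(k₁) · F^{(m-1)}(k₂) · F^{(m)}(k₃) equals ∑_{j=0}^{n} F^{(m-1)}(j) · (𝒫(n-j) − F^{(m)}(n-j)) − ∑_{j=0}^{n-1} 𝒫(j) · F^{(m)}(n-1-j). -/
/-- Fibonacci `m`-step numbers: `fibm m 0 = 0`, `fibm m 1 = 1`, and for `n ≥ 2`,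
`fibm m n = ∑_{j=1}^{m} fibm m (n - j)`, negative indices counting as `0`
(equivalently via truncated subtraction, since `fibm m 0 = 0`). -/
def fibm (m : ℕ) : ℕ → ℤ
  | 0 => 0
  | 1 => 1
  | n + 2 => ∑ j ∈ Finset.range m, fibm m (n + 1 - j)
decreasing_by exact Nat.lt_succ_of_le (Nat.sub_le _ _)

/-- Pell numbers: `pell 0 = 0`, `pell 1 = 1`, `pell (n+2) = 2 * pell (n+1) + pell n`. -/
def pell : ℕ → ℤ
  | 0 => 0
  | 1 => 1
  | n + 2 => 2 * pell (n + 1) + pell n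

open PowerSeries

theorem fibm_zero (m : ℕ) : fibm m 0 = 0 := by rw [fibm]

theorem fibm_one (m : ℕ) : fibm m 1 = 1 := by rw [fibm]

theorem fibm_add_two (m n : ℕ) :
    fibm m (n + 2) = ∑ j ∈ Finset.range m, fibm m (n + 1 - j) := by
  rw [fibm]

/-- The ordinary generating function of the Fibonacci `m`-step numbers. -/
noncomputable def fibmSeries (m : ℕ) : ℤ⟦X⟧ := PowerSeries.mk (fibm m)

/-- The ordinary generating function of the Pell numbers. -/
noncomputable def pellSeries : ℤ⟦X⟧ := PowerSeries.mk pell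

theorem coeff_fibmSeries (m n : ℕ) : coeff n (fibmSeries m) = fibm m n := coeff_mk n _

theorem coeff_pellSeries (n : ℕ) : coeff n pellSeries = pell n := coeff_mk n _

theorem fibmSeries_eq (m : ℕ) :
    fibmSeries m = X + X * (∑ j ∈ Finset.range m, X ^ j) * fibmSeries m := by
  ext n
  rw [mul_assoc, Finset.sum_mul, map_add, coeff_fibmSeries]
  rcases n with _ | _ | n
  · simp [fibm_zero]
  · rw [coeff_succ_X_mul, map_sum, Finset.sum_eq_zero, fibm_one, coeff_one_X, add_zero]
    intro j _
    rw [coeff_X_pow_mul']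
    split_ifs <;> simp [coeff_fibmSeries, fibm_zero]
  · rw [coeff_succ_X_mul, map_sum, fibm_add_two, coeff_X, if_neg (by omega), zero_add]
    refine Finset.sum_congr rfl fun j _ => ?_
    rw [coeff_X_pow_mul']
    split_ifs with h
    · rw [coeff_fibmSeries]
    · rw [Nat.sub_eq_zero_of_le (by omega), fibm_zero]

theorem pellSeries_eq : pellSeries = X + X * (2 * pellSeries + X * pellSeries) := by
  ext n
  rw [map_add, coeff_pellSeries]
  rcases n with _ | _ | n
  · simp [pell]
  · rw [coeff_succ_X_mul, two_mul]
    rw [map_add, map_add, coeff_zero_X_mul, coeff_pellSeries, coeff_one_X]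
    simp [pell]
  · rw [coeff_succ_X_mul, map_add, coeff_succ_X_mul, two_mul, map_add, coeff_X,
      if_neg (by omega), coeff_pellSeries, coeff_pellSeries, pell]
    ring

theorem pellSeries_mul_fibmSeries (k : ℕ) :
    X * (pellSeries * (fibmSeries k * fibmSeries (k + 1))) =
      fibmSeries k * (pellSeries - fibmSeries (k + 1)) -
        X * (pellSeries * fibmSeries (k + 1)) := by
  have hG := fibmSeries_eq k
  have hF := fibmSeries_eq (k + 1)
  have hP := pellSeries_eq
  rw [Finset.sum_range_succ', pow_zero] at hF
  simp_rw [pow_succ'] at hF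
  rw [← Finset.mul_sum] at hF
  generalize ∑ j ∈ Finset.range k, (X : ℤ⟦X⟧) ^ j = S at hF hG
  generalize fibmSeries k = G at *
  generalize fibmSeries (k + 1) = F at *
  generalize pellSeries = P at *
  refine mul_left_cancel₀ (X_ne_zero (R := ℤ)) ?_
  linear_combination G * P * hF - G * F * hP - X * P * F * hG

theorem coeff_mul_eq_sum_range (n : ℕ) (f g : ℤ⟦X⟧) :
    coeff n (f * g) = ∑ j ∈ Finset.range (n + 1), coeff j f * coeff (n - j) g := by
  rw [coeff_mul, Finset.Nat.sum_antidiagonal_eq_sum_range_succ_mk]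

theorem coeff_mul_mul_eq_sum_antidiagonalTuple (n : ℕ) (f g h : ℤ⟦X⟧) :
    coeff n (f * (g * h)) = ∑ k ∈ Finset.Nat.antidiagonalTuple 3 n,
      coeff (k 0) f * coeff (k 1) g * coeff (k 2) h := by
  simp_rw [coeff_mul, Finset.mul_sum]
  rw [Finset.sum_sigma']
  refine Finset.sum_nbij' (fun p => ![p.1.1, p.2.1, p.2.2])
    (fun k => ⟨(k 0, k 1 + k 2), (k 1, k 2)⟩) ?_ ?_ ?_ ?_ ?_
  · rintro ⟨⟨a, b⟩, ⟨c, d⟩⟩ hp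
    simp only [Finset.mem_sigma, Finset.HasAntidiagonal.mem_antidiagonal] at hp
    simp [Finset.Nat.mem_antidiagonalTuple, Fin.sum_univ_three]
    omega
  · intro k hk
    rw [Finset.Nat.mem_antidiagonalTuple, Fin.sum_univ_three] at hk
    simp only [Finset.mem_sigma, Finset.HasAntidiagonal.mem_antidiagonal, and_true]
    omega
  · rintro ⟨⟨a, b⟩, ⟨c, d⟩⟩ hp
    simp only [Finset.mem_sigma, Finset.HasAntidiagonal.mem_antidiagonal] at hp
    obtain ⟨-, rfl⟩ := hp
    rfl
  · intro k _
    ext i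
    fin_cases i <;> rfl
  · rintro ⟨⟨a, b⟩, ⟨c, d⟩⟩ _
    simp [mul_assoc]

theorem stmt_16 (m : ℕ) (hm : 2 ≤ m) (n : ℕ) (hn : 1 ≤ n) :
    ∑ k ∈ Finset.Nat.antidiagonalTuple 3 (n - 1),
        pell (k 0) * fibm (m - 1) (k 1) * fibm m (k 2) =
      (∑ j ∈ Finset.range (n + 1), fibm (m - 1) j * (pell (n - j) - fibm m (n - j))) -
        ∑ j ∈ Finset.range n, pell j * fibm m (n - 1 - j) := by
  obtain ⟨k, rfl⟩ : ∃ k, m = k + 1 := ⟨m - 1, by omega⟩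
  obtain ⟨n, rfl⟩ : ∃ l, n = l + 1 := ⟨n - 1, by omega⟩
  have h := congrArg (coeff (n + 1)) (pellSeries_mul_fibmSeries k)
  rw [map_sub, coeff_succ_X_mul, coeff_succ_X_mul, coeff_mul_mul_eq_sum_antidiagonalTuple,
    coeff_mul_eq_sum_range, coeff_mul_eq_sum_range] at h
  simpa only [map_sub, coeff_fibmSeries, coeff_pellSeries, Nat.add_sub_cancel] using h
end

section
/- For every integer n ≥ 0, the sum over all triples (k₁, k₂, k₃) of nonnegative integers with k₁ + k₂ + k₃ = n of F(k₁) · T(k₂) · Q(k₃) equals Q(n+4) + Q(n+2) − T(n+5) + F(n+3). -/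
open PowerSeries in
/-- The generating function of the Fibonacci `m`-step numbers is `X / (1 - X - ⋯ - X ^ m)`. -/
theorem mk_fibm_mul (m : ℕ) :
    mk (fibm m) * (1 - ∑ j ∈ Finset.range m, (X : ℤ⟦X⟧) ^ (j + 1)) = X := by
  ext n
  simp only [mul_sub, mul_one, Finset.mul_sum, map_sub, map_sum, coeff_mk, coeff_mul_X_pow']
  match n with
  | 0 => simp [fibm]
  | 1 => simp [fibm, coeff_X]
  | n + 2 =>
    have h (j : ℕ) : (if j + 1 ≤ n + 2 then fibm m (n + 2 - (j + 1)) else 0) =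
        fibm m (n + 1 - j) := by
      split_ifs with hj
      · congr 1; omega
      · rw [show n + 1 - j = 0 by omega, fibm]
    simp only [h]
    rw [fibm, coeff_X, if_neg (by omega), sub_self]

open PowerSeries in
/-- The coefficients of a product of three power series, summed over triples. -/
theorem sum_antidiagonalTuple_three {R : Type*} [CommSemiring R] (f g h : ℕ → R) (n : ℕ) :
    ∑ k ∈ Finset.Nat.antidiagonalTuple 3 n, f (k 0) * g (k 1) * h (k 2) =
      coeff n (mk f * (mk g * mk h)) := by
  simp only [coeff_mul, coeff_mk, Finset.mul_sum]
  rw [Finset.sum_sigma']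
  refine Finset.sum_bij' (fun k _ => ⟨(k 0, k 1 + k 2), (k 1, k 2)⟩)
    (fun p _ => ![p.1.1, p.2.1, p.2.2]) ?_ ?_ ?_ ?_ ?_
  · intro k hk
    simp only [Finset.Nat.mem_antidiagonalTuple, Fin.sum_univ_three] at hk
    simp only [Finset.mem_sigma, Finset.HasAntidiagonal.mem_antidiagonal, and_true]
    omega
  · rintro ⟨⟨a, b⟩, c, d⟩ hp
    simp only [Finset.mem_sigma, Finset.HasAntidiagonal.mem_antidiagonal] at hp
    simp only [Finset.Nat.mem_antidiagonalTuple, Fin.sum_univ_three, Matrix.cons_val]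
    omega
  · intro k _
    ext i
    fin_cases i <;> rfl
  · rintro ⟨⟨a, b⟩, c, d⟩ hp
    simp only [Finset.mem_sigma, Finset.HasAntidiagonal.mem_antidiagonal] at hp
    obtain ⟨-, rfl⟩ := hp
    rfl
  · intro k _
    exact mul_assoc _ _ _

open PowerSeries in
/-- The product of the Fibonacci, Tribonacci and Tetranacci generating functions, after clearing
denominators, is a combination of the three series. -/
theorem mk_fibm_mul_mk_fibm_mul_mk_fibm :
    X ^ 5 * ((1 + X) * (mk (fibm 2) * (mk (fibm 3) * mk (fibm 4)))) =
      mk (fibm 4) - mk (fibm 3) - X * mk (fibm 3) + X * mk (fibm 2) := by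
  have hF := mk_fibm_mul 2
  have hT := mk_fibm_mul 3
  have hQ := mk_fibm_mul 4
  simp only [Finset.sum_range_succ, Finset.sum_range_zero] at hF hT hQ
  generalize mk (fibm 2) = f at *
  generalize mk (fibm 3) = t at *
  generalize mk (fibm 4) = q at *
  have hX : (X : ℤ⟦X⟧) ≠ 0 := X_ne_zero
  have hft : X ^ 2 * (f * t) = t - f :=
    mul_left_cancel₀ hX (by linear_combination t * hF - f * hT)
  have htq : X ^ 3 * (t * q) = q - t :=
    mul_left_cancel₀ hX (by linear_combination q * hT - t * hQ)
  have hfq : X ^ 2 * (1 + X) * (f * q) = q - f :=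
    mul_left_cancel₀ hX (by linear_combination q * hF - f * hQ)
  linear_combination X ^ 3 * (1 + X) * q * hft + (1 + X) * htq - X * hfq

theorem stmt_18 (n : ℕ) :
    ∑ k ∈ Finset.Nat.antidiagonalTuple 3 n, fibm 2 (k 0) * fibm 3 (k 1) * fibm 4 (k 2) =
      fibm 4 (n + 4) + fibm 4 (n + 2) - fibm 3 (n + 5) + fibm 2 (n + 3) := by
  rw [sum_antidiagonalTuple_three]
  induction n with
  | zero => simp [fibm, Finset.sum_range_succ]
  | succ n ih =>
    have h := congrArg (PowerSeries.coeff (n + 1 + 5)) mk_fibm_mul_mk_fibm_mul_mk_fibm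
    simp only [PowerSeries.coeff_X_pow_mul, add_mul, one_mul, map_add, map_sub,
      PowerSeries.coeff_succ_X_mul, PowerSeries.coeff_mk] at h
    have hQ : fibm 4 (n + 6) =
        fibm 4 (n + 5) + fibm 4 (n + 4) + fibm 4 (n + 3) + fibm 4 (n + 2) := by
      rw [fibm]; simp [Finset.sum_range_succ]
    have hF : fibm 2 (n + 5) = fibm 2 (n + 4) + fibm 2 (n + 3) := by
      rw [fibm]; simp [Finset.sum_range_succ]
    simp only [add_assoc, Nat.reduceAdd] at h ⊢
    linarith
end
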